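/- Let the coefficients satisfy Hypotheses (H) and let G(t,s) be the associated evolution operator. If {μ_t^{(1)} : t ≥ 0} and {μ_t^{(2)} : t ≥ 0} are both tight evolution systems of measures for G(t,s), then μ_t^{(1)} = μ_t^{(2)} for every t ≥ 0; i.e., G(t,s) admits at most one tight evolution system of measures. -/

import Mathlib

open MeasureTheory Filter Topology Metric Set
open scoped RealInnerProductSpace

noncomputable section

abbrev Ed (d : ℕ) := EuclideanSpace ℝ (Fin d)

/-- `f` belongs to `C_b(ℝ^d)`: it is bounded and continuous. -/
def IsCb {d : ℕ} (f : Ed d → ℝ) : Prop :=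
  Continuous f ∧ ∃ M, ∀ x, |f x| ≤ M

/-- The action of the operator `A(t)φ = Tr(Q(t,·)D²φ) + ⟨b(t,·),∇φ⟩`. -/
def applyA {d : ℕ} (q : ℝ → Ed d → Matrix (Fin d) (Fin d) ℝ) (b : ℝ → Ed d → Ed d)
    (t : ℝ) (u : Ed d → ℝ) (x : Ed d) : ℝ :=
  (∑ i, ∑ j, q t x i j *
      iteratedFDeriv ℝ 2 u x ![EuclideanSpace.single i 1, EuclideanSpace.single j 1]) +
    ⟪b t x, gradient u x⟫

/-- `u` is a bounded classical solution (in `C_b([s,∞)×ℝ^d) ∩ C^{1,2}((s,∞)×ℝ^d)`)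
of `D_t u = A(t)u` on `(s,∞)×ℝ^d` with `u(s,·) = f`. -/
structure IsBoundedClassicalSolution {d : ℕ} (q : ℝ → Ed d → Matrix (Fin d) (Fin d) ℝ)
    (b : ℝ → Ed d → Ed d) (s : ℝ) (f : Ed d → ℝ) (u : ℝ → Ed d → ℝ) : Prop where
  cont : ContinuousOn (fun z : ℝ × Ed d => u z.1 z.2) (Ici s ×ˢ (univ : Set (Ed d)))
  bdd : ∃ M, ∀ t ∈ Ici s, ∀ x, |u t x| ≤ M
  smooth_space : ∀ t ∈ Ioi s, ContDiff ℝ 2 (u t)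
  pde : ∀ t ∈ Ioi s, ∀ x, HasDerivAt (fun τ => u τ x) (applyA q b t (u t) x) t
  init : ∀ x, u s x = f x

/-- Hypotheses (H), together with the associated evolution operator `G(t,s)`. -/
structure Hypotheses (d : ℕ) where
  /-- the Hölder exponent -/
  α : ℝ
  hα : α ∈ Ioo (0:ℝ) 1
  /-- the diffusion coefficients -/
  q : ℝ → Ed d → Matrix (Fin d) (Fin d) ℝ
  /-- the drift coefficients -/
  b : ℝ → Ed d → Ed d
  /-- the ellipticity function -/
  η : ℝ → Ed d → ℝ
  η₀ : ℝ
  -- (i): local regularity `C^{α/2,1+α}_loc`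
  q_diff : ∀ t ∈ Ici (0:ℝ), ∀ i j, Differentiable ℝ fun x => q t x i j
  b_diff : ∀ t ∈ Ici (0:ℝ), Differentiable ℝ (b t)
  q_locHolder : ∀ i j, ∀ T > (0:ℝ), ∀ R > (0:ℝ), ∃ L : ℝ,
    ∀ t ∈ Icc (0:ℝ) T, ∀ s ∈ Icc (0:ℝ) T,
      ∀ x ∈ closedBall (0 : Ed d) R, ∀ y ∈ closedBall (0 : Ed d) R,
        |q t x i j - q s y i j| ≤ L * (|t - s| ^ (α/2) + ‖x - y‖ ^ α) ∧
        ‖gradient (fun z => q t z i j) x - gradient (fun z => q s z i j) y‖ ≤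
          L * (|t - s| ^ (α/2) + ‖x - y‖ ^ α)
  b_locHolder : ∀ i, ∀ T > (0:ℝ), ∀ R > (0:ℝ), ∃ L : ℝ,
    ∀ t ∈ Icc (0:ℝ) T, ∀ s ∈ Icc (0:ℝ) T,
      ∀ x ∈ closedBall (0 : Ed d) R, ∀ y ∈ closedBall (0 : Ed d) R,
        |b t x i - b s y i| ≤ L * (|t - s| ^ (α/2) + ‖x - y‖ ^ α) ∧
        ‖gradient (fun z => b t z i) x - gradient (fun z => b s z i) y‖ ≤
          L * (|t - s| ^ (α/2) + ‖x - y‖ ^ α)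
  -- (i): boundedness on `[0,∞) × B_R` and uniform-in-time `L^p(B_R)` bounds
  q_bdd : ∀ R > (0:ℝ), ∃ M : ℝ, ∀ t ∈ Ici (0:ℝ), ∀ x ∈ ball (0 : Ed d) R, ∀ i j,
    |q t x i j| ≤ M
  q_cont : ∀ R > (0:ℝ), ∀ i j, ContinuousOn (fun z : ℝ × Ed d => q z.1 z.2 i j)
    (Ici (0:ℝ) ×ˢ ball (0 : Ed d) R)
  int_bdd : ∃ p : ℝ, (d : ℝ) + 2 < p ∧ ∀ R > (0:ℝ), ∃ M : ℝ, ∀ t ∈ Ici (0:ℝ), ∀ i j : Fin d,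
    (∫ x in ball (0 : Ed d) R, ‖gradient (fun z => q t z i j) x‖ ^ p) ≤ M ∧
    (∫ x in ball (0 : Ed d) R, |b t x j| ^ p) ≤ M
  -- (ii): symmetry and ellipticity
  q_symm : ∀ t ∈ Ici (0:ℝ), ∀ x, (q t x).IsSymm
  hη₀ : 0 < η₀
  η_lb : ∀ t ∈ Ici (0:ℝ), ∀ x, η₀ ≤ η t x
  ellipticity : ∀ t ∈ Ici (0:ℝ), ∀ x, ∀ ξ : Ed d,
    η t x * ‖ξ‖ ^ 2 ≤ ∑ i, ∑ j, q t x i j * ξ i * ξ j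
  -- (iii): Lyapunov function
  V : Ed d → ℝ
  V_pos : ∀ x, 0 < V x
  V_C2 : ContDiff ℝ 2 V
  V_tendsto : Tendsto V (comap (fun x : Ed d => ‖x‖) atTop) atTop
  a : ℝ
  κ : ℝ
  ha : 0 ≤ a
  hκ : 0 < κ
  lyapunov : ∀ t ∈ Ici (0:ℝ), ∀ x, applyA q b t V x ≤ a - κ * V x
  -- (iv): bounds on the space derivatives of the coefficients
  c₀ : ℝ
  r₀ : ℝ
  hc₀ : 0 ≤ c₀
  gradQ_bdd : ∀ t ∈ Ici (0:ℝ), ∀ x,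
    Real.sqrt (∑ i, ∑ j, ‖gradient (fun z => q t z i j) x‖ ^ 2) ≤ c₀ * η t x
  b_dissip : ∀ t ∈ Ici (0:ℝ), ∀ x, ∀ ξ : Ed d, ⟪fderiv ℝ (b t) x ξ, ξ⟫ ≤ r₀ * ‖ξ‖ ^ 2
  -- (v): growth conditions
  growth : ∃ c > (0:ℝ),
    (∀ t ∈ Ici (0:ℝ), ∀ x,
        Real.sqrt (∑ i, ∑ j, (q t x i j) ^ 2) ≤ c * (1 + ‖x‖) * V x ∧
        ⟪b t x, x⟫ ≤ c * (1 + ‖x‖ ^ 2) * V x) ∨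
    (∀ t ∈ Ici (0:ℝ), ∀ x, Real.sqrt (∑ i, ∑ j, (q t x i j) ^ 2) ≤ c)
  /-- the evolution operator -/
  G : ℝ → ℝ → (Ed d → ℝ) → Ed d → ℝ
  G_sol : ∀ s ∈ Ici (0:ℝ), ∀ f, IsCb f →
    IsBoundedClassicalSolution q b s f fun t => G t s f
  G_unique : ∀ s ∈ Ici (0:ℝ), ∀ f, IsCb f → ∀ u,
    IsBoundedClassicalSolution q b s f u → ∀ t ∈ Ici s, ∀ x, u t x = G t s f x

/-- `{μ_t : t ≥ 0}` is an evolution system of measures for `G(t,s)`. -/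
def IsEvolutionSystem {d : ℕ} (H : Hypotheses d) (μ : ℝ → Measure (Ed d)) : Prop :=
  (∀ t ∈ Ici (0:ℝ), IsProbabilityMeasure (μ t)) ∧
    ∀ f, IsCb f → ∀ s ∈ Ici (0:ℝ), ∀ t ∈ Ici s,
      ∫ x, H.G t s f x ∂μ t = ∫ x, f x ∂μ s

/-- The system `{μ_t : t ≥ 0}` is tight. -/
def IsTightSystem {d : ℕ} (μ : ℝ → Measure (Ed d)) : Prop :=
  ∀ ε > (0:ℝ), ∃ R > (0:ℝ), ∀ t ∈ Ici (0:ℝ),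
    ENNReal.ofReal (1 - ε) ≤ μ t (ball (0 : Ed d) R)


lemma exists_sqrt_matrix {d : ℕ} (A : Matrix (Fin d) (Fin d) ℝ) (hA : A.IsSymm) (l : ℝ) (hl : 0 < l)
    (hlow : ∀ ξ : Fin d → ℝ, l * ∑ i, ξ i ^ 2 ≤ ∑ i, ∑ j, A i j * ξ i * ξ j) :
    ∃ S : Matrix (Fin d) (Fin d) ℝ, S.IsSymm ∧ S * S = A ∧
      ∀ ξ : Fin d → ℝ, √l * ∑ i, ξ i ^ 2 ≤ ∑ i, ∑ j, S i j * ξ i * ξ j := by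
  have hH : A.IsHermitian := by
    rw [Matrix.IsHermitian, Matrix.conjTranspose_eq_transpose_of_trivial]; exact hA
  set v := hH.eigenvectorBasis with hv
  set e := hH.eigenvalues with he
  have heig : ∀ k i, ∑ j, A i j * v k j = e k * v k i := by
    intro k i
    have := congrFun (hH.mulVec_eigenvectorBasis k) i
    simpa [Matrix.mulVec, dotProduct] using this
  have horth : ∀ k m, ∑ i, v k i * v m i = if k = m then 1 else 0 := by
    intro k m
    have := (orthonormal_iff_ite.mp v.orthonormal) k m
    rw [← this]
    simp [PiLp.inner_apply, mul_comm]
  have hcomp : ∀ x : Fin d → ℝ, ∀ i, ∑ k, (∑ j, v k j * x j) * v k i = x i := by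
    intro x i
    have := congrArg (fun z : EuclideanSpace ℝ (Fin d) => z i) (v.sum_repr' (WithLp.toLp 2 x))
    simp only [PiLp.inner_apply] at this
    simpa [mul_comm] using this
  have hpars : ∀ x : Fin d → ℝ, ∑ k, (∑ j, v k j * x j) ^ 2 = ∑ i, x i ^ 2 := by
    intro x
    have h1 : ∑ i, x i ^ 2 = ∑ i, (∑ k, (∑ j, v k j * x j) * v k i) * x i := by
      refine Finset.sum_congr rfl fun i _ => ?_
      rw [hcomp]; ring
    rw [h1]
    simp_rw [Finset.sum_mul]
    rw [Finset.sum_comm]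
    refine Finset.sum_congr rfl fun k _ => ?_
    rw [sq]
    have : ∀ i, (∑ j, v k j * x j) * v k i * x i = (∑ j, v k j * x j) * (v k i * x i) :=
      fun i => by ring
    simp only [← Finset.sum_mul]
    simp_rw [this, ← Finset.mul_sum]
  have hle : ∀ k, l ≤ e k := by
    intro k
    have h1 := hlow (fun i => v k i)
    have h2 : ∑ i, ∑ j, A i j * v k i * v k j = e k := by
      have : ∀ i, ∑ j, A i j * v k i * v k j = e k * (v k i * v k i) := by
        intro i
        rw [← mul_assoc, ← heig, Finset.sum_mul]
        exact Finset.sum_congr rfl fun j _ => by ring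
      simp_rw [this, ← Finset.mul_sum, horth]; simp
    have h3 : ∑ i, v k i ^ 2 = 1 := by
      have := horth k k
      simp only [if_true] at this
      rw [← this]; exact Finset.sum_congr rfl fun j _ => by ring
    rw [h2, h3] at h1; linarith
  refine ⟨Matrix.of fun i j => ∑ k, √(e k) * v k i * v k j, ?_, ?_, ?_⟩
  · ext i j
    simp only [Matrix.transpose_apply, Matrix.of_apply]
    exact Finset.sum_congr rfl fun k _ => by ring
  · ext i j
    rw [Matrix.mul_apply]
    simp only [Matrix.of_apply]
    have h1 : ∀ m, (∑ k, √(e k) * v k i * v k m) * (∑ k, √(e k) * v k m * v k j) =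
        ∑ k, ∑ k', √(e k) * √(e k') * v k i * v k' j * (v k m * v k' m) := by
      intro m
      rw [Finset.sum_mul_sum]
      exact Finset.sum_congr rfl fun i _ => Finset.sum_congr rfl fun j _ => by ring
    simp_rw [h1]
    rw [Finset.sum_comm]
    have h2 : ∀ k, ∑ m, ∑ k', √(e k) * √(e k') * v k i * v k' j * (v k m * v k' m)
        = e k * v k i * v k j := by
      intro k
      rw [Finset.sum_comm]
      simp_rw [← Finset.mul_sum, horth]
      simp only [mul_ite, mul_one, mul_zero, Finset.sum_ite_eq, Finset.mem_univ, if_true]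
      rw [Real.mul_self_sqrt (hl.le.trans (hle k))]
    simp_rw [h2, ← heig, Finset.sum_mul]
    rw [Finset.sum_comm]
    have h3 := hcomp (fun m => A i m) j
    rw [← h3]
    rw [Finset.sum_comm]
    refine Finset.sum_congr rfl fun k _ => ?_
    rw [Finset.sum_mul]
    exact Finset.sum_congr rfl fun j _ => by ring
  · intro ξ
    have h1 : ∑ i, ∑ j, (∑ k, √(e k) * v k i * v k j) * ξ i * ξ j
        = ∑ k, √(e k) * (∑ j, v k j * ξ j) ^ 2 := by
      simp_rw [sq, Finset.sum_mul_sum, Finset.mul_sum, Finset.sum_mul]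
      rw [Finset.sum_comm' (t' := Finset.univ) (s' := fun _ => Finset.univ) (by simp)]
      rw [Finset.sum_congr rfl (fun i _ => Finset.sum_comm), Finset.sum_comm]
      refine Finset.sum_congr rfl fun k _ => ?_
      rw [Finset.sum_comm]
      exact Finset.sum_congr rfl fun i _ => Finset.sum_congr rfl fun j _ => by ring
    change _ ≤ ∑ i, ∑ j, (∑ k, √(e k) * v k i * v k j) * ξ i * ξ j
    rw [h1, ← hpars ξ, Finset.mul_sum]
    exact Finset.sum_le_sum fun k _ =>
      mul_le_mul_of_nonneg_right (Real.sqrt_le_sqrt (hle k)) (sq_nonneg _)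

lemma sqrt_perturb {d : ℕ} (S T : Matrix (Fin d) (Fin d) ℝ) (hT : T.IsSymm)
    (m : ℝ) (hS' : ∀ ξ : Fin d → ℝ, m * ∑ i, ξ i ^ 2 ≤ ∑ i, ∑ j, S i j * ξ i * ξ j)
    (hT' : ∀ ξ : Fin d → ℝ, m * ∑ i, ξ i ^ 2 ≤ ∑ i, ∑ j, T i j * ξ i * ξ j) (hm : 0 ≤ m) :
    4 * m ^ 2 * ∑ i, ∑ j, (S i j - T i j) ^ 2 ≤ ∑ i, ∑ j, ((S * S) i j - (T * T) i j) ^ 2 := by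
  set X := S - T with hX
  set D := S * S - T * T with hD
  have hDX : D = S * X + X * T := by rw [hD, hX]; noncomm_ring
  have e1 : ∑ i, ∑ j, (S i j - T i j) ^ 2 = ∑ i, ∑ j, X i j ^ 2 := by simp [hX]
  have e2 : ∑ i, ∑ j, ((S * S) i j - (T * T) i j) ^ 2 = ∑ i, ∑ j, D i j ^ 2 := by simp [hD]
  rw [e1, e2]
  have h1 : m * ∑ i, ∑ j, X i j ^ 2 ≤ ∑ i, ∑ j, X i j * (S * X) i j := by
    rw [Finset.sum_comm, Finset.mul_sum]
    conv_rhs => rw [Finset.sum_comm]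
    refine Finset.sum_le_sum fun j _ => (hS' fun i => X i j).trans (le_of_eq ?_)
    refine Finset.sum_congr rfl fun i _ => ?_
    rw [Matrix.mul_apply, Finset.mul_sum]
    exact Finset.sum_congr rfl fun k _ => by ring
  have h2 : m * ∑ i, ∑ j, X i j ^ 2 ≤ ∑ i, ∑ j, X i j * (X * T) i j := by
    rw [Finset.mul_sum]
    refine Finset.sum_le_sum fun i _ => (hT' fun j => X i j).trans (le_of_eq ?_)
    refine Finset.sum_congr rfl fun j _ => ?_
    rw [Matrix.mul_apply, Finset.mul_sum]
    refine Finset.sum_congr rfl fun k _ => ?_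
    rw [← hT.apply j k]; ring
  have h3 : ∑ i, ∑ j, X i j * D i j = ∑ i, ∑ j, X i j * (S * X) i j
      + ∑ i, ∑ j, X i j * (X * T) i j := by
    simp only [← Finset.sum_add_distrib]
    refine Finset.sum_congr rfl fun i _ => Finset.sum_congr rfl fun j _ => ?_
    rw [hDX, Matrix.add_apply]; ring
  have h4 : (0:ℝ) ≤ ∑ i, ∑ j, (D i j - 2 * m * X i j) ^ 2 :=
    Finset.sum_nonneg fun i _ => Finset.sum_nonneg fun j _ => sq_nonneg _
  have h5 : ∑ i, ∑ j, (D i j - 2 * m * X i j) ^ 2 = ∑ i, ∑ j, D i j ^ 2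
      - 4 * m * ∑ i, ∑ j, X i j * D i j + 4 * m ^ 2 * ∑ i, ∑ j, X i j ^ 2 := by
    simp only [Finset.mul_sum, ← Finset.sum_add_distrib, ← Finset.sum_sub_distrib]
    exact Finset.sum_congr rfl fun i _ => Finset.sum_congr rfl fun j _ => by ring
  rw [h5, h3] at h4
  nlinarith [mul_le_mul_of_nonneg_left h1 hm, mul_le_mul_of_nonneg_left h2 hm]

/-- second derivative test -/
lemma second_deriv_nonpos {F F' : ℝ → ℝ} {c : ℝ} (h1 : ∀ᶠ τ in 𝓝 0, HasDerivAt F (F' τ) τ)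
    (h2 : HasDerivAt F' c 0) (hmax : IsLocalMax F 0) : F' 0 = 0 ∧ c ≤ 0 := by
  have h0 : F' 0 = 0 := hmax.hasDerivAt_eq_zero h1.self_of_nhds
  refine ⟨h0, ?_⟩
  by_contra hc
  push Not at hc
  have hd : deriv F =ᶠ[𝓝 0] F' := h1.mono fun τ h => h.deriv
  have hdd : deriv (deriv F) 0 = c := by rw [hd.deriv_eq, h2.deriv]
  have hmin : IsLocalMin F 0 := by
    apply isLocalMin_of_deriv_deriv_pos
    · rw [hdd]; exact hc
    · rw [h1.self_of_nhds.deriv, h0]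
    · exact h1.self_of_nhds.continuousAt
  have hconst : F =ᶠ[𝓝 0] fun _ => F 0 := by
    filter_upwards [hmin, hmax] with τ a b using le_antisymm b a
  have : deriv (deriv F) 0 = 0 := by
    have h3 : deriv F =ᶠ[𝓝 0] fun _ => 0 := by
      have := hconst.deriv
      simpa using this
    rw [h3.deriv_eq]; simp
  linarith

lemma line_C2 {d : ℕ} {φ : Ed d → ℝ} (h : ContDiff ℝ 2 φ) (x p : Ed d) :
    (∀ τ : ℝ, HasDerivAt (fun τ : ℝ => φ (x + τ • p)) (fderiv ℝ φ (x + τ • p) p) τ) ∧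
    HasDerivAt (fun τ : ℝ => fderiv ℝ φ (x + τ • p) p) (fderiv ℝ (fderiv ℝ φ) x p p) 0 := by
  have hl : ∀ τ : ℝ, HasDerivAt (fun τ : ℝ => x + τ • p) p τ := fun τ => by
    simpa using ((hasDerivAt_id τ).smul_const p).const_add x
  have hd : Differentiable ℝ φ := h.differentiable (by norm_num)
  have hd2 : Differentiable ℝ (fderiv ℝ φ) :=
    (h.fderiv_right (m := 1) (by norm_num)).differentiable (by norm_num)
  refine ⟨fun τ => (hd _).hasFDerivAt.comp_hasDerivAt τ (hl τ), ?_⟩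
  have h1 : HasDerivAt (fun τ : ℝ => fderiv ℝ φ (x + τ • p)) (fderiv ℝ (fderiv ℝ φ) x p) 0 := by
    have := (hd2 (x + (0:ℝ) • p)).hasFDerivAt.comp_hasDerivAt 0 (hl 0)
    simpa [Function.comp_def] using this
  exact h1.clm_apply (hasDerivAt_const 0 p) |>.congr_deriv (by simp)

lemma line_norm {d : ℕ} (z v : Ed d) (hz : z ≠ 0) (K : ℝ) :
    (∀ᶠ τ in 𝓝 (0:ℝ), HasDerivAt (fun τ : ℝ => 1 - Real.exp (-K * ‖z + τ • v‖))
      (K * Real.exp (-K * ‖z + τ • v‖) * (⟪z + τ • v, v⟫ / ‖z + τ • v‖)) τ) ∧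
    HasDerivAt (fun τ : ℝ => K * Real.exp (-K * ‖z + τ • v‖) * (⟪z + τ • v, v⟫ / ‖z + τ • v‖))
      (K * Real.exp (-K * ‖z‖) * (‖v‖ ^ 2 / ‖z‖ - ⟪z, v⟫ ^ 2 / ‖z‖ ^ 3 - K * ⟪z, v⟫ ^ 2 / ‖z‖ ^ 2)) 0 := by
  have hl : ∀ τ : ℝ, HasDerivAt (fun τ : ℝ => z + τ • v) v τ := fun τ => by
    simpa using ((hasDerivAt_id τ).smul_const v).const_add z
  have hn : ∀ τ : ℝ, z + τ • v ≠ 0 →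
      HasDerivAt (fun τ : ℝ => ‖z + τ • v‖) (⟪z + τ • v, v⟫ / ‖z + τ • v‖) τ := by
    intro τ h
    have h1 := (hl τ).norm_sq.sqrt (by positivity)
    simp only [Real.sqrt_sq (norm_nonneg _)] at h1
    exact h1.congr_deriv (by field_simp)
  have he : ∀ τ : ℝ, z + τ • v ≠ 0 → HasDerivAt (fun τ : ℝ => Real.exp (-K * ‖z + τ • v‖))
      (Real.exp (-K * ‖z + τ • v‖) * (-K * (⟪z + τ • v, v⟫ / ‖z + τ • v‖))) τ :=
    fun τ h => ((hn τ h).const_mul (-K)).exp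
  constructor
  · have : ∀ᶠ τ in 𝓝 (0:ℝ), z + τ • v ≠ 0 := by
      have hc : ContinuousAt (fun τ : ℝ => z + τ • v) 0 := (hl 0).continuousAt
      exact hc.eventually_ne (by simpa using hz)
    filter_upwards [this] with τ h
    exact ((he τ h).const_sub 1).congr_deriv (by ring)
  · have h0 : z + (0:ℝ) • v ≠ 0 := by simpa using hz
    have hi : HasDerivAt (fun τ : ℝ => ⟪z + τ • v, v⟫) (‖v‖ ^ 2) 0 := by
      have := (hl 0).inner ℝ (hasDerivAt_const (0:ℝ) v)
      exact this.congr_deriv (by simp)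
    have := ((he 0 h0).const_mul K).mul (hi.div (hn 0 h0) (by simpa using hz))
    refine this.congr_deriv ?_
    have hz' : ‖z‖ ≠ 0 := by simpa using hz
    simp only [zero_smul, add_zero, Pi.div_apply]
    field_simp
    ring

lemma bilin_expand {d : ℕ} (B : Ed d →L[ℝ] Ed d →L[ℝ] ℝ) (p : Ed d) :
    B p p = ∑ i, ∑ j, p i * p j * B (EuclideanSpace.single i 1) (EuclideanSpace.single j 1) := by
  have hp : p = ∑ i, p i • (EuclideanSpace.single i (1:ℝ) : Ed d) := by
    have := (EuclideanSpace.basisFun (Fin d) ℝ).sum_repr p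
    simpa using this.symm
  conv_lhs => rw [hp]
  simp only [map_sum, map_smul, _root_.sum_apply, _root_.smul_apply,
    smul_eq_mul, Finset.mul_sum]
  rw [Finset.sum_comm]
  exact Finset.sum_congr rfl fun i _ => Finset.sum_congr rfl fun j _ => by ring

/-- the `k`-th column of a matrix as a Euclidean vector -/
def colv {d : ℕ} (S : Matrix (Fin d) (Fin d) ℝ) (k : Fin d) : Ed d := WithLp.toLp 2 (fun i => S i k)

lemma trace_cols {d : ℕ} (B : Ed d →L[ℝ] Ed d →L[ℝ] ℝ) (S : Matrix (Fin d) (Fin d) ℝ) :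
    ∑ i, ∑ j, (S * S.transpose) i j * B (EuclideanSpace.single i 1) (EuclideanSpace.single j 1)
      = ∑ k, B (colv S k) (colv S k) := by
  simp_rw [bilin_expand B (colv S _)]
  conv_rhs => rw [Finset.sum_comm]
  refine Finset.sum_congr rfl fun i _ => ?_
  conv_rhs => rw [Finset.sum_comm]
  refine Finset.sum_congr rfl fun j _ => ?_
  rw [Matrix.mul_apply, Finset.sum_mul]
  rfl

lemma inner_gradient {d : ℕ} (φ : Ed d → ℝ) (x v : Ed d) : ⟪v, gradient φ x⟫ = fderiv ℝ φ x v := by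
  rw [real_inner_comm, gradient, InnerProductSpace.toDual_symm_apply]

lemma applyA_eq {d : ℕ} (q : ℝ → Ed d → Matrix (Fin d) (Fin d) ℝ) (b : ℝ → Ed d → Ed d)
    (t : ℝ) (φ : Ed d → ℝ) (x : Ed d) :
    applyA q b t φ x = ∑ i, ∑ j, q t x i j *
      fderiv ℝ (fderiv ℝ φ) x (EuclideanSpace.single i 1) (EuclideanSpace.single j 1)
      + fderiv ℝ φ x (b t x) := by
  unfold applyA
  rw [inner_gradient]
  simp only [iteratedFDeriv_two_apply, Matrix.cons_val_zero, Matrix.cons_val_one]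

lemma applyA_comb {d : ℕ} (q : ℝ → Ed d → Matrix (Fin d) (Fin d) ℝ) (b : ℝ → Ed d → Ed d)
    (t : ℝ) (φ V : Ed d → ℝ) (hφ : ContDiff ℝ 2 φ) (hV : ContDiff ℝ 2 V) (a c : ℝ) (x : Ed d) :
    applyA q b t (fun y => a * φ y + c * V y) x
      = a * applyA q b t φ x + c * applyA q b t V x := by
  have h1 : Differentiable ℝ φ := hφ.differentiable (by norm_num)
  have h2 : Differentiable ℝ V := hV.differentiable (by norm_num)
  have h1' : Differentiable ℝ (fderiv ℝ φ) :=
    (hφ.fderiv_right (m := 1) (by norm_num)).differentiable (by norm_num)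
  have h2' : Differentiable ℝ (fderiv ℝ V) :=
    (hV.fderiv_right (m := 1) (by norm_num)).differentiable (by norm_num)
  have e1 : fderiv ℝ (fun y => a * φ y + c * V y) = fun y => a • fderiv ℝ φ y + c • fderiv ℝ V y := by
    funext y
    exact (((h1 y).hasFDerivAt.const_mul a).add ((h2 y).hasFDerivAt.const_mul c)).fderiv
  have e2 : fderiv ℝ (fun y => a • fderiv ℝ φ y + c • fderiv ℝ V y) x
      = a • fderiv ℝ (fderiv ℝ φ) x + c • fderiv ℝ (fderiv ℝ V) x :=
    (((h1' x).hasFDerivAt.const_smul a).add ((h2' x).hasFDerivAt.const_smul c)).fderiv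
  simp only [applyA_eq, e1, e2]
  simp only [_root_.add_apply, _root_.smul_apply, smul_eq_mul]
  have : ∀ i j, q t x i j * (a * fderiv ℝ (fderiv ℝ φ) x (EuclideanSpace.single i 1) (EuclideanSpace.single j 1)
      + c * fderiv ℝ (fderiv ℝ V) x (EuclideanSpace.single i 1) (EuclideanSpace.single j 1))
      = a * (q t x i j * fderiv ℝ (fderiv ℝ φ) x (EuclideanSpace.single i 1) (EuclideanSpace.single j 1))
      + c * (q t x i j * fderiv ℝ (fderiv ℝ V) x (EuclideanSpace.single i 1) (EuclideanSpace.single j 1)) :=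
    fun i j => by ring
  simp only [this, Finset.sum_add_distrib, ← Finset.mul_sum]
  ring

/-- maximum principle at a global maximum point, single variable -/
lemma applyA_nonpos_of_max {d : ℕ} (q : ℝ → Ed d → Matrix (Fin d) (Fin d) ℝ) (b : ℝ → Ed d → Ed d)
    (t : ℝ) (φ : Ed d → ℝ) (hφ : ContDiff ℝ 2 φ) (x : Ed d) (hmax : ∀ y, φ y ≤ φ x)
    (S : Matrix (Fin d) (Fin d) ℝ) (hS : q t x = S * S.transpose) :
    applyA q b t φ x ≤ 0 := by
  have key : ∀ p, fderiv ℝ φ x p = 0 ∧ fderiv ℝ (fderiv ℝ φ) x p p ≤ 0 := by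
    intro p
    obtain ⟨h1, h2⟩ := line_C2 hφ x p
    have := second_deriv_nonpos (Eventually.of_forall h1) h2
      (Eventually.of_forall fun τ => by simpa using hmax (x + τ • p))
    simpa using this
  rw [applyA_eq, (key _).1, hS, trace_cols, add_zero]
  exact Finset.sum_nonpos fun k _ => (key _).2

lemma coupling_dir {d : ℕ} {φ₁ φ₂ : Ed d → ℝ} (h₁ : ContDiff ℝ 2 φ₁) (h₂ : ContDiff ℝ 2 φ₂)
    (x y : Ed d) (hxy : x - y ≠ 0) (θ K : ℝ)
    (hmax : ∀ x' y', φ₁ x' + φ₂ y' - θ * (1 - Real.exp (-K * ‖x' - y'‖)) ≤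
      φ₁ x + φ₂ y - θ * (1 - Real.exp (-K * ‖x - y‖))) (p p' : Ed d) :
    fderiv ℝ φ₁ x p + fderiv ℝ φ₂ y p' =
      θ * (K * Real.exp (-K * ‖x - y‖) * (⟪x - y, p - p'⟫ / ‖x - y‖)) ∧
    fderiv ℝ (fderiv ℝ φ₁) x p p + fderiv ℝ (fderiv ℝ φ₂) y p' p' ≤
      θ * (K * Real.exp (-K * ‖x - y‖) * (‖p - p'‖ ^ 2 / ‖x - y‖
        - ⟪x - y, p - p'⟫ ^ 2 / ‖x - y‖ ^ 3 - K * ⟪x - y, p - p'⟫ ^ 2 / ‖x - y‖ ^ 2)) := by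
  obtain ⟨a1, a2⟩ := line_C2 h₁ x p
  obtain ⟨b1, b2⟩ := line_C2 h₂ y p'
  obtain ⟨c1, c2⟩ := line_norm (x - y) (p - p') hxy K
  have := second_deriv_nonpos
    (F := fun τ : ℝ => φ₁ (x + τ • p) + φ₂ (y + τ • p')
      - θ * (1 - Real.exp (-K * ‖(x - y) + τ • (p - p')‖)))
    (c1.mono fun τ hτ => ((a1 τ).add (b1 τ)).sub (hτ.const_mul θ))
    ((a2.add b2).sub (c2.const_mul θ))
    (Eventually.of_forall fun τ => by
      have := hmax (x + τ • p) (y + τ • p')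
      have e : x + τ • p - (y + τ • p') = (x - y) + τ • (p - p') := by module
      rw [e] at this
      simpa using this)
  simp only [zero_smul, add_zero] at this
  exact ⟨by linarith [this.1], by linarith [this.2]⟩

lemma coupling_main {d : ℕ} (q : ℝ → Ed d → Matrix (Fin d) (Fin d) ℝ) (b : ℝ → Ed d → Ed d)
    (t : ℝ) {φ₁ φ₂ : Ed d → ℝ} (h₁ : ContDiff ℝ 2 φ₁) (h₂ : ContDiff ℝ 2 φ₂)
    (x y : Ed d) (hxy : x - y ≠ 0) (θ K : ℝ) (hθ : 0 ≤ θ) (hK : 0 ≤ K)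
    (hmax : ∀ x' y', φ₁ x' + φ₂ y' - θ * (1 - Real.exp (-K * ‖x' - y'‖)) ≤
      φ₁ x + φ₂ y - θ * (1 - Real.exp (-K * ‖x - y‖)))
    (S T : Matrix (Fin d) (Fin d) ℝ) (l r₀ : ℝ) (hl : 0 ≤ l)
    (hS : q t x = S * S.transpose + l • 1) (hT : q t y = T * T.transpose + l • 1)
    (hb : ⟪b t x - b t y, x - y⟫ ≤ r₀ * ‖x - y‖ ^ 2) :
    applyA q b t φ₁ x + applyA q b t φ₂ y ≤ θ * (K * Real.exp (-K * ‖x - y‖) *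
      ((∑ i, ∑ j, (S i j - T i j) ^ 2) / ‖x - y‖ - 4 * K * l + r₀ * ‖x - y‖)) := by
  have dir := coupling_dir h₁ h₂ x y hxy θ K hmax
  set z := x - y with hz
  set r := ‖z‖ with hr
  have hr0 : 0 < r := norm_pos_iff.mpr hxy
  set w := K * Real.exp (-K * r) with hw
  have hw0 : 0 ≤ w := by positivity
  set B₁ := fderiv ℝ (fderiv ℝ φ₁) x
  set B₂ := fderiv ℝ (fderiv ℝ φ₂) y
  -- reflection matrices
  set I₁ : Matrix (Fin d) (Fin d) ℝ := √l • 1 with hI₁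
  set I₂ : Matrix (Fin d) (Fin d) ℝ :=
    √l • (1 - (2 / r ^ 2) • Matrix.vecMulVec (fun i => z i) (fun i => z i)) with hI₂
  have hzz : ∑ i, z i * z i = r ^ 2 := by
    rw [hr, EuclideanSpace.norm_sq_eq]
    exact Finset.sum_congr rfl fun i _ => by rw [Real.norm_eq_abs, sq_abs, sq]
  have hI₁' : I₁ * I₁.transpose = l • 1 := by
    rw [hI₁, Matrix.transpose_smul, Matrix.transpose_one, Matrix.smul_mul, Matrix.mul_smul, mul_one,
      smul_smul, Real.mul_self_sqrt hl]
  have hI₂' : I₂ * I₂.transpose = l • 1 := by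
    have hP : Matrix.vecMulVec (fun i => z i) (fun i => z i) *
        Matrix.vecMulVec (fun i => z i) (fun i => z i) =
        (r ^ 2) • Matrix.vecMulVec (fun i => z i) (fun i => z i) := by
      ext i j
      rw [Matrix.mul_apply]
      simp only [Matrix.vecMulVec_apply, Matrix.smul_apply, smul_eq_mul]
      rw [← hzz, Finset.sum_mul]
      exact Finset.sum_congr rfl fun i _ => by ring
    have hPt : (Matrix.vecMulVec (fun i => z i) (fun i => z i)).transpose
        = Matrix.vecMulVec (fun i => z i) (fun i => z i) := by
      ext i j; simp [Matrix.vecMulVec_apply, mul_comm]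
    rw [hI₂, Matrix.transpose_smul, Matrix.transpose_sub, Matrix.transpose_one, Matrix.transpose_smul,
      hPt, Matrix.smul_mul, Matrix.mul_smul, smul_smul, Real.mul_self_sqrt hl]
    congr 1
    rw [sub_mul, mul_sub, mul_sub, one_mul, one_mul, mul_one, Matrix.smul_mul, Matrix.mul_smul, hP,
      smul_smul, smul_smul]
    have : (2 / r ^ 2 * (2 / r ^ 2) * r ^ 2) = 2 / r ^ 2 + 2 / r ^ 2 := by field_simp; norm_num
    rw [this, add_smul]; abel
  have hcol : ∀ k, colv I₁ k - colv I₂ k = (√l * (2 / r ^ 2) * z k) • z := by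
    intro k
    ext i
    simp [colv, hI₁, hI₂, Matrix.vecMulVec_apply]
    ring
  have first : fderiv ℝ φ₁ x (b t x) + fderiv ℝ φ₂ y (b t y) ≤ θ * (w * (r₀ * r)) := by
    rw [(dir (b t x) (b t y)).1]
    refine mul_le_mul_of_nonneg_left (mul_le_mul_of_nonneg_left ?_ hw0) hθ
    rw [real_inner_comm, div_le_iff₀ hr0]
    calc _ ≤ r₀ * r ^ 2 := hb
      _ = _ := by ring
  have second₁ : ∑ k, B₁ (colv S k) (colv S k) + ∑ k, B₂ (colv T k) (colv T k)
      ≤ θ * (w * ((∑ i, ∑ j, (S i j - T i j) ^ 2) / r)) := by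
    rw [← Finset.sum_add_distrib]
    have : (∑ i, ∑ j, (S i j - T i j) ^ 2) = ∑ k, ‖colv S k - colv T k‖ ^ 2 := by
      rw [Finset.sum_comm]
      refine Finset.sum_congr rfl fun k _ => ?_
      rw [EuclideanSpace.norm_sq_eq]
      exact Finset.sum_congr rfl fun i _ => by simp [colv]
    rw [this, Finset.sum_div, Finset.mul_sum, Finset.mul_sum]
    refine Finset.sum_le_sum fun k _ => ((dir (colv S k) (colv T k)).2).trans ?_
    refine mul_le_mul_of_nonneg_left (mul_le_mul_of_nonneg_left ?_ hw0) hθ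
    have p1 : 0 ≤ ⟪z, colv S k - colv T k⟫ ^ 2 / r ^ 3 := by positivity
    have p2 : 0 ≤ K * ⟪z, colv S k - colv T k⟫ ^ 2 / r ^ 2 := by positivity
    linarith
  have second₂ : ∑ k, B₁ (colv I₁ k) (colv I₁ k) + ∑ k, B₂ (colv I₂ k) (colv I₂ k)
      ≤ θ * (w * (- 4 * K * l)) := by
    rw [← Finset.sum_add_distrib]
    have e : θ * (w * (- 4 * K * l)) = ∑ k, θ * (w * (- 4 * K * l * (z k * z k) / r ^ 2)) := by
      rw [← Finset.mul_sum, ← Finset.mul_sum, ← Finset.sum_div, ← Finset.mul_sum, hzz]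
      congr 2; field_simp
    rw [e]
    refine Finset.sum_le_sum fun k _ => ((dir (colv I₁ k) (colv I₂ k)).2).trans (le_of_eq ?_)
    rw [hcol, norm_smul, inner_smul_right, real_inner_self_eq_norm_sq, ← hr, mul_pow, Real.norm_eq_abs, sq_abs]
    have hsl : √l ^ 2 = l := Real.sq_sqrt hl
    congr 2
    simp only [mul_pow, hsl]
    field_simp
    ring
  have tx : ∑ i, ∑ j, q t x i j * B₁ (EuclideanSpace.single i 1) (EuclideanSpace.single j 1)
      = ∑ k, B₁ (colv S k) (colv S k) + ∑ k, B₁ (colv I₁ k) (colv I₁ k) := by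
    rw [hS, ← hI₁']
    simp only [Matrix.add_apply, add_mul, Finset.sum_add_distrib]
    rw [trace_cols, trace_cols]
  have ty : ∑ i, ∑ j, q t y i j * B₂ (EuclideanSpace.single i 1) (EuclideanSpace.single j 1)
      = ∑ k, B₂ (colv T k) (colv T k) + ∑ k, B₂ (colv I₂ k) (colv I₂ k) := by
    rw [hT, ← hI₂']
    simp only [Matrix.add_apply, add_mul, Finset.sum_add_distrib]
    rw [trace_cols, trace_cols]
  rw [applyA_eq, applyA_eq, tx, ty]
  have : θ * (w * ((∑ i, ∑ j, (S i j - T i j) ^ 2) / r - 4 * K * l + r₀ * r)) =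
    θ * (w * ((∑ i, ∑ j, (S i j - T i j) ^ 2) / r)) + θ * (w * (- 4 * K * l)) + θ * (w * (r₀ * r)) := by
    ring
  rw [this]
  linarith

lemma hyp_dissip {d : ℕ} (H : Hypotheses d) (t : ℝ) (ht : t ∈ Ici (0:ℝ)) (x y : Ed d) :
    ⟪H.b t x - H.b t y, x - y⟫ ≤ H.r₀ * ‖x - y‖ ^ 2 := by
  have hl : ∀ τ : ℝ, HasDerivAt (fun τ : ℝ => y + τ • (x - y)) (x - y) τ := fun τ => by
    simpa using ((hasDerivAt_id τ).smul_const (x - y)).const_add y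
  have hd : ∀ τ : ℝ, HasDerivAt (fun τ : ℝ => ⟪H.b t (y + τ • (x - y)), x - y⟫)
      ⟪fderiv ℝ (H.b t) (y + τ • (x - y)) (x - y), x - y⟫ τ := by
    intro τ
    have h1 := (H.b_diff t ht (y + τ • (x - y))).hasFDerivAt.comp_hasDerivAt τ (hl τ)
    have h2 := h1.inner ℝ (hasDerivAt_const τ (x - y))
    simpa [Function.comp_def] using h2
  obtain ⟨c, -, hc⟩ := exists_hasDerivAt_eq_slope (fun τ : ℝ => ⟪H.b t (y + τ • (x - y)), x - y⟫) _
    (zero_lt_one) (fun τ _ => (hd τ).continuousAt.continuousWithinAt) (fun τ _ => hd τ)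
  have h3 := H.b_dissip t ht (y + c • (x - y)) (x - y)
  rw [hc] at h3
  simp only [one_smul, zero_smul, add_zero, sub_zero, div_one, add_sub_cancel] at h3
  rwa [← inner_sub_left] at h3

lemma hyp_fderiv_q {d : ℕ} (H : Hypotheses d) (t : ℝ) (ht : t ∈ Ici (0:ℝ)) (x v : Ed d) (i j : Fin d) :
    |fderiv ℝ (fun z => H.q t z i j) x v| ≤ H.c₀ * H.η t x * ‖v‖ := by
  rw [← inner_gradient]
  have h1 := abs_real_inner_le_norm v (gradient (fun z => H.q t z i j) x)
  have h2 : ‖gradient (fun z => H.q t z i j) x‖ ≤ H.c₀ * H.η t x := by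
    refine le_trans ?_ (H.gradQ_bdd t ht x)
    apply Real.le_sqrt_of_sq_le
    calc ‖gradient (fun z => H.q t z i j) x‖ ^ 2
        ≤ ∑ j, ‖gradient (fun z => H.q t z i j) x‖ ^ 2 :=
          Finset.single_le_sum (f := fun j => ‖gradient (fun z => H.q t z i j) x‖ ^ 2)
            (fun _ _ => by positivity) (Finset.mem_univ j)
      _ ≤ _ := Finset.single_le_sum
            (f := fun i => ∑ j, ‖gradient (fun z => H.q t z i j) x‖ ^ 2)
            (fun _ _ => by positivity) (Finset.mem_univ i)
  calc _ ≤ _ := h1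
    _ ≤ ‖v‖ * (H.c₀ * H.η t x) := by gcongr
    _ = _ := by ring

lemma hyp_form_compare {d : ℕ} (H : Hypotheses d) (t : ℝ) (ht : t ∈ Ici (0:ℝ)) (x y ξ : Ed d) :
    ∑ i, ∑ j, H.q t x i j * ξ i * ξ j ≤
      Real.exp (H.c₀ * d * ‖x - y‖) * ∑ i, ∑ j, H.q t y i j * ξ i * ξ j := by
  set v := x - y with hv
  set c := H.c₀ * d * ‖v‖ with hc
  have hl : ∀ τ : ℝ, HasDerivAt (fun τ : ℝ => y + τ • v) v τ := fun τ => by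
    simpa using ((hasDerivAt_id τ).smul_const v).const_add y
  have hq : ∀ τ : ℝ, ∀ i j, HasDerivAt (fun τ : ℝ => H.q t (y + τ • v) i j)
      (fderiv ℝ (fun z => H.q t z i j) (y + τ • v) v) τ := fun τ i j => by
    have h := (H.q_diff t ht i j (y + τ • v)).hasFDerivAt
    exact h.comp_hasDerivAt τ (hl τ)
  have hm : ∀ τ : ℝ, HasDerivAt (fun τ : ℝ => ∑ i, ∑ j, H.q t (y + τ • v) i j * ξ i * ξ j)
      (∑ i, ∑ j, fderiv ℝ (fun z => H.q t z i j) (y + τ • v) v * ξ i * ξ j) τ := fun τ =>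
    HasDerivAt.fun_sum fun i _ => HasDerivAt.fun_sum fun j _ =>
      ((hq τ i j).mul_const (ξ i)).mul_const (ξ j)
  have hbound : ∀ τ : ℝ, ∑ i, ∑ j, fderiv ℝ (fun z => H.q t z i j) (y + τ • v) v * ξ i * ξ j ≤
      c * ∑ i, ∑ j, H.q t (y + τ • v) i j * ξ i * ξ j := by
    intro τ
    set e := H.η t (y + τ • v) with he
    have hηpos : 0 ≤ e := H.hη₀.le.trans (H.η_lb t ht _)
    have hc₀ := H.hc₀
    calc _ ≤ ∑ i, ∑ j, H.c₀ * e * ‖v‖ * (|ξ i| * |ξ j|) := by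
          refine Finset.sum_le_sum fun i _ => Finset.sum_le_sum fun j _ => ?_
          refine (le_abs_self _).trans ?_
          rw [abs_mul, abs_mul, mul_assoc]
          exact mul_le_mul_of_nonneg_right (hyp_fderiv_q H t ht _ v i j) (by positivity)
      _ = H.c₀ * e * ‖v‖ * (∑ i, |ξ i|) ^ 2 := by
          rw [sq, Finset.sum_mul_sum]
          simp only [Finset.mul_sum]
      _ ≤ H.c₀ * e * ‖v‖ * (d * ‖ξ‖ ^ 2) := by
          have : (∑ i, |ξ i|) ^ 2 ≤ d * ‖ξ‖ ^ 2 := by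
            have := sq_sum_le_card_mul_sum_sq (s := Finset.univ) (f := fun i => |ξ i|)
            simpa [EuclideanSpace.norm_sq_eq] using this
          gcongr
      _ = c * (e * ‖ξ‖ ^ 2) := by rw [hc]; ring
      _ ≤ _ := mul_le_mul_of_nonneg_left (H.ellipticity t ht _ ξ) (by positivity)
  have hF : ∀ τ : ℝ, HasDerivAt
      (fun τ : ℝ => (∑ i, ∑ j, H.q t (y + τ • v) i j * ξ i * ξ j) * Real.exp (-c * τ)) _ τ :=
    fun τ => (hm τ).mul (((hasDerivAt_id τ).const_mul (-c)).exp)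
  have hanti : Antitone
      (fun τ : ℝ => (∑ i, ∑ j, H.q t (y + τ • v) i j * ξ i * ξ j) * Real.exp (-c * τ)) := by
    apply antitone_of_deriv_nonpos (fun τ => (hF τ).differentiableAt)
    intro τ
    rw [(hF τ).deriv]
    have := hbound τ
    simp only [id_eq]
    nlinarith [Real.exp_pos (-c * τ)]
  have h01 := hanti (zero_le_one)
  simp only [one_smul, zero_smul, add_zero, mul_zero, Real.exp_zero, mul_one] at h01
  have hx : y + v = x := by rw [hv]; abel
  rw [hx, Real.exp_neg, ← div_eq_mul_inv, div_le_iff₀ (Real.exp_pos _)] at h01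
  linarith

lemma hyp_pkg {d : ℕ} (H : Hypotheses d) (t : ℝ) (ht : t ∈ Ici (0:ℝ)) (x y : Ed d) (hxy : x - y ≠ 0) :
    ∃ (l : ℝ) (S T : Matrix (Fin d) (Fin d) ℝ),
      Real.exp (-(H.c₀ * d * ‖x - y‖)) * H.η₀ / 2 ≤ l ∧
      H.q t x = S * S.transpose + l • 1 ∧ H.q t y = T * T.transpose + l • 1 ∧
      ∑ i, ∑ j, (S i j - T i j) ^ 2 ≤
        (d:ℝ) ^ 2 * H.c₀ ^ 2 * Real.exp (H.c₀ * d * ‖x - y‖) ^ 4 * ‖x - y‖ ^ 2 * l := by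
  set r := ‖x - y‖ with hr
  set E := Real.exp (H.c₀ * d * r) with hE
  have hc₀ := H.hc₀
  have hr0 : 0 ≤ r := norm_nonneg _
  have hE0 : 0 < E := Real.exp_pos _
  have hE1 : 1 ≤ E := Real.one_le_exp (by positivity)
  have hEneg : Real.exp (-(H.c₀ * d * r)) = E⁻¹ := Real.exp_neg _
  rw [hEneg]
  -- the smallest eigenvalue at `y`
  obtain ⟨ξ₀, hξ₀, hmin⟩ := (isCompact_sphere (0 : Ed d) 1).exists_isMinOn
    (f := fun ξ => ∑ i, ∑ j, H.q t y i j * ξ i * ξ j)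
    ⟨‖x - y‖⁻¹ • (x - y), by simp [norm_smul, hxy]⟩ (by fun_prop)
  set L := ∑ i, ∑ j, H.q t y i j * ξ₀ i * ξ₀ j with hL
  have hξ₀' : ‖ξ₀‖ = 1 := by simpa using hξ₀
  have hLlow : H.η₀ ≤ L := by
    have := H.ellipticity t ht y ξ₀
    rw [hξ₀', one_pow, mul_one] at this
    exact (H.η_lb t ht y).trans this
  have hL0 : 0 < L := H.hη₀.trans_le hLlow
  have hlowy : ∀ ξ : Ed d, L * ‖ξ‖ ^ 2 ≤ ∑ i, ∑ j, H.q t y i j * ξ i * ξ j := by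
    intro ξ
    rcases eq_or_ne ξ 0 with rfl | h
    · simp
    have hn : 0 < ‖ξ‖ := norm_pos_iff.mpr h
    have h1 : L ≤ ∑ i, ∑ j, H.q t y i j * (‖ξ‖⁻¹ • ξ) i * (‖ξ‖⁻¹ • ξ) j :=
      hmin (a := ‖ξ‖⁻¹ • ξ) (by simp [norm_smul, h])
    have h2 : ∑ i, ∑ j, H.q t y i j * (‖ξ‖⁻¹ • ξ) i * (‖ξ‖⁻¹ • ξ) j =
        (‖ξ‖⁻¹) ^ 2 * ∑ i, ∑ j, H.q t y i j * ξ i * ξ j := by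
      simp only [Finset.mul_sum]
      refine Finset.sum_congr rfl fun i _ => Finset.sum_congr rfl fun j _ => ?_
      simp only [PiLp.smul_apply, smul_eq_mul]; ring
    rw [h2, inv_pow, inv_mul_eq_div, le_div_iff₀ (by positivity)] at h1
    exact h1
  have hlowx : ∀ ξ : Ed d, E⁻¹ * L * ‖ξ‖ ^ 2 ≤ ∑ i, ∑ j, H.q t x i j * ξ i * ξ j := by
    intro ξ
    have h1 := hyp_form_compare H t ht y x ξ
    rw [norm_sub_rev, ← hr, ← hE] at h1
    rw [mul_assoc, inv_mul_le_iff₀ hE0]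
    exact (hlowy ξ).trans h1
  -- the difference of entries
  have hdiff : ∀ i j, |H.q t x i j - H.q t y i j| ≤ H.c₀ * (E * L) * r := by
    intro i j
    have := (convex_segment (𝕜 := ℝ) y x).norm_image_sub_le_of_norm_fderiv_le
      (f := fun z => H.q t z i j) (C := H.c₀ * (E * L))
      (fun z _ => H.q_diff t ht i j z) (fun z hz => ?_) (left_mem_segment ℝ y x)
      (right_mem_segment ℝ y x)
    · simpa using this
    · refine ContinuousLinearMap.opNorm_le_bound _ (by positivity) fun v => ?_
      refine (hyp_fderiv_q H t ht z v i j).trans ?_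
      have h1 := H.ellipticity t ht z ξ₀
      rw [hξ₀', one_pow, mul_one] at h1
      have h2 := hyp_form_compare H t ht z y ξ₀
      have h3 : ‖z - y‖ ≤ r := by
        obtain ⟨a, ha, rfl⟩ := (segment_eq_image' ℝ y x) ▸ hz
        rw [add_sub_cancel_left, norm_smul, Real.norm_eq_abs, abs_of_nonneg ha.1]
        exact mul_le_of_le_one_left hr0 ha.2
      have h4 : Real.exp (H.c₀ * d * ‖z - y‖) ≤ E := Real.exp_le_exp.mpr (by gcongr)
      have h5 : H.η t z ≤ E * L := h1.trans (h2.trans (mul_le_mul_of_nonneg_right h4 hL0.le))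
      gcongr
  set l := E⁻¹ * L / 2 with hl
  have hl0 : 0 < l := by positivity
  have hsum : ∀ (A : Matrix (Fin d) (Fin d) ℝ),
      (∀ ξ : Ed d, 2 * l * ‖ξ‖ ^ 2 ≤ ∑ i, ∑ j, A i j * ξ i * ξ j) → ∀ ξ : Fin d → ℝ,
      l * ∑ i, ξ i ^ 2 ≤ ∑ i, ∑ j, (A - l • (1 : Matrix (Fin d) (Fin d) ℝ)) i j * ξ i * ξ j := by
    intro A hA ξ
    have h1 := hA (WithLp.toLp 2 ξ)
    rw [EuclideanSpace.norm_sq_eq] at h1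
    simp only [Real.norm_eq_abs, sq_abs] at h1
    have h2 : ∑ i, ∑ j, (A - l • (1 : Matrix (Fin d) (Fin d) ℝ)) i j * ξ i * ξ j =
        ∑ i, ∑ j, A i j * ξ i * ξ j - l * ∑ i, ξ i ^ 2 := by
      simp only [Matrix.sub_apply, Matrix.smul_apply, smul_eq_mul, sub_mul, Finset.sum_sub_distrib,
        Finset.mul_sum]
      congr 1
      refine Finset.sum_congr rfl fun i _ => ?_
      simp [Matrix.one_apply]
      ring
    rw [h2]; linarith
  have hsymm : ∀ z, (H.q t z - l • (1 : Matrix (Fin d) (Fin d) ℝ)).IsSymm := fun z =>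
    (H.q_symm t ht z).sub (Matrix.isSymm_one.smul l)
  obtain ⟨S, hS1, hS2, hS3⟩ := exists_sqrt_matrix _ (hsymm x) l hl0
    (hsum _ fun ξ => by
      have := hlowx ξ
      rw [hl]; linarith)
  obtain ⟨T, hT1, hT2, hT3⟩ := exists_sqrt_matrix _ (hsymm y) l hl0
    (hsum _ fun ξ => by
      have h1 := hlowy ξ
      have h2 : E⁻¹ ≤ 1 := inv_le_one_of_one_le₀ hE1
      have h3 : 2 * l ≤ L := by rw [hl]; nlinarith
      exact (mul_le_mul_of_nonneg_right h3 (by positivity)).trans h1)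
  refine ⟨l, S, T, ?_, ?_, ?_, ?_⟩
  · rw [hl]; gcongr
  · rw [hS1.eq, hS2]; abel
  · rw [hT1.eq, hT2]; abel
  · have h1 := sqrt_perturb S T hT1 (√l) hS3 hT3 (by positivity)
    rw [hS2, hT2, Real.sq_sqrt hl0.le] at h1
    have h2 : ∑ i, ∑ j, ((H.q t x - l • (1 : Matrix (Fin d) (Fin d) ℝ)) i j
        - (H.q t y - l • (1 : Matrix (Fin d) (Fin d) ℝ)) i j) ^ 2 ≤
        ∑ i : Fin d, ∑ j : Fin d, (H.c₀ * (E * L) * r) ^ 2 := by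
      refine Finset.sum_le_sum fun i _ => Finset.sum_le_sum fun j _ => ?_
      simp only [Matrix.sub_apply, sub_sub_sub_cancel_right]
      rw [← sq_abs]
      have := hdiff i j
      gcongr
    have h3 := h1.trans h2
    simp only [Finset.sum_const, Finset.card_univ, Fintype.card_fin, nsmul_eq_mul] at h3
    have hLl : L = 2 * E * l := by rw [hl]; field_simp
    rw [hLl] at h3
    have h4 : (d:ℝ) * (d * (H.c₀ * (E * (2 * E * l)) * r) ^ 2) =
      4 * l * ((d:ℝ) ^ 2 * H.c₀ ^ 2 * E ^ 4 * r ^ 2 * l) := by ring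
    rw [h4] at h3
    exact le_of_mul_le_mul_left h3 (by positivity)

/-- the two-point Lyapunov function -/
def Phi {d : ℕ} (V : Ed d → ℝ) (K R ε : ℝ) (x y : Ed d) : ℝ :=
  min (1 - Real.exp (-K * ‖x - y‖)) (1 - Real.exp (-K * R)) + ε * (V x + V y)

lemma V_large {d : ℕ} (H : Hypotheses d) (L : ℝ) : ∃ R > (0:ℝ), ∀ x, R ≤ ‖x‖ → L < H.V x := by
  have h := H.V_tendsto.eventually (eventually_gt_atTop L)
  rw [eventually_comap] at h
  obtain ⟨R, hR⟩ := eventually_atTop.mp h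
  exact ⟨max R 1, by positivity, fun x hx => hR ‖x‖ ((le_max_left _ _).trans hx) x rfl⟩

set_option maxHeartbeats 2000000 in
lemma generator_ineq {d : ℕ} (H : Hypotheses d) : ∃ K R ε lam : ℝ, 0 < K ∧ 0 < R ∧ 0 < ε ∧ 0 < lam ∧
    ∀ t ∈ Ici (0:ℝ), ∀ u : Ed d → ℝ, ContDiff ℝ 2 u → ∀ x y : Ed d, x - y ≠ 0 → ∀ θ > (0:ℝ),
      (∀ x' y', u x' - u y' - θ * Phi H.V K R ε x' y' ≤ u x - u y - θ * Phi H.V K R ε x y) →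
      applyA H.q H.b t u x - applyA H.q H.b t u y ≤ - (θ * lam * Phi H.V K R ε x y) := by
  have ha := H.ha
  have hκ := H.hκ
  have hη₀ := H.hη₀
  have hc₀ := H.hc₀
  obtain ⟨L, hLdef⟩ : ∃ L, L = 4 * H.a / H.κ + 1 := ⟨_, rfl⟩
  have hL1 : 0 < L := by rw [hLdef]; positivity
  have hL2 : 4 * H.a ≤ H.κ * L := by rw [hLdef, mul_add, mul_div_cancel₀ _ hκ.ne']; linarith
  obtain ⟨ρ, hρ, hVρ⟩ := V_large H L
  obtain ⟨R, hRdef⟩ : ∃ R, R = 2 * ρ := ⟨_, rfl⟩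
  have hR : 0 < R := by rw [hRdef]; positivity
  have hfar : ∀ x y : Ed d, R ≤ ‖x - y‖ → L < H.V x + H.V y := by
    intro x y h
    have hx := H.V_pos x
    have hy := H.V_pos y
    by_cases h1 : ρ ≤ ‖x‖
    · linarith [hVρ x h1]
    · have : ρ ≤ ‖y‖ := by linarith [norm_sub_le x y]
      linarith [hVρ y this]
  obtain ⟨E, hE⟩ : ∃ E, E = Real.exp (H.c₀ * d * R) := ⟨_, rfl⟩
  have hE0 : 0 < E := by rw [hE]; exact Real.exp_pos _
  obtain ⟨l₀, hl₀⟩ : ∃ l₀, l₀ = E⁻¹ * H.η₀ / 2 := ⟨_, rfl⟩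
  have hl₀0 : 0 < l₀ := by rw [hl₀]; positivity
  obtain ⟨N, hN⟩ : ∃ N, N = (d:ℝ) ^ 2 * H.c₀ ^ 2 * E ^ 4 := ⟨_, rfl⟩
  have hN0 : 0 ≤ N := by rw [hN]; positivity
  obtain ⟨K, hK⟩ : ∃ K, K = (N * R + |H.r₀| * R / l₀ + 1) / 4 := ⟨_, rfl⟩
  have hK0 : 0 < K := by rw [hK]; positivity
  obtain ⟨c, hc⟩ : ∃ c, c = K * Real.exp (-K * R) * l₀ := ⟨_, rfl⟩
  have hc0 : 0 < c := by rw [hc]; positivity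
  obtain ⟨ε, hε⟩ : ∃ ε, ε = c / (4 * (H.a + 1)) := ⟨_, rfl⟩
  have hε0 : 0 < ε := by rw [hε]; positivity
  have hε1 : 2 * H.a * ε ≤ c / 2 := by
    rw [hε, ← mul_div_assoc, div_le_div_iff₀ (by positivity) (by norm_num)]
    nlinarith
  obtain ⟨lam, hlam⟩ : ∃ lam, lam = min (H.κ / 4) (min (ε * H.κ * L / 4) (c / 2)) := ⟨_, rfl⟩
  have hlam0 : 0 < lam := by rw [hlam]; positivity
  have hlam1 : lam ≤ H.κ / 4 := by rw [hlam]; exact min_le_left _ _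
  have hlam2 : lam ≤ ε * H.κ * L / 4 := by
    rw [hlam]; exact (min_le_right _ _).trans (min_le_left _ _)
  have hlam3 : lam ≤ c / 2 := by
    rw [hlam]; exact (min_le_right _ _).trans (min_le_right _ _)
  refine ⟨K, R, ε, lam, hK0, hR, hε0, hlam0, ?_⟩
  intro t ht u hu x y hxy θ hθ hmax
  set r := ‖x - y‖ with hr
  have hr0 : 0 < r := norm_pos_iff.mpr hxy
  have hLx := H.lyapunov t ht x
  have hLy := H.lyapunov t ht y
  have hVx := H.V_pos x
  have hVy := H.V_pos y
  set W := H.V x + H.V y with hW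
  have hC₁ : ContDiff ℝ 2 fun z => 1 * u z + (-(θ * ε)) * H.V z :=
    (contDiff_const.mul hu).add (contDiff_const.mul H.V_C2)
  have hC₂ : ContDiff ℝ 2 fun z => (-1) * u z + (-(θ * ε)) * H.V z :=
    (contDiff_const.mul hu).add (contDiff_const.mul H.V_C2)
  have hA₁ := applyA_comb H.q H.b t u H.V hu H.V_C2 1 (-(θ * ε)) x
  have hA₂ := applyA_comb H.q H.b t u H.V hu H.V_C2 (-1) (-(θ * ε)) y
  have hψ1 : min (1 - Real.exp (-K * r)) (1 - Real.exp (-K * R)) ≤ 1 :=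
    (min_le_left _ _).trans (by linarith [Real.exp_pos (-K * r)])
  have hPhi : Phi H.V K R ε x y ≤ 1 + ε * W := by unfold Phi; linarith
  have hθε : 0 < θ * ε := by positivity
  -- it suffices to estimate the coupled part
  suffices hcoup : ∃ p : ℝ, applyA H.q H.b t (fun z => 1 * u z + (-(θ * ε)) * H.V z) x +
      applyA H.q H.b t (fun z => (-1) * u z + (-(θ * ε)) * H.V z) y ≤ θ * p ∧
      p + ε * (2 * H.a - H.κ * W) ≤ - (lam * (1 + ε * W)) by
    obtain ⟨p, hp1, hp2⟩ := hcoup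
    rw [hA₁, hA₂] at hp1
    have h1 : θ * ε * (applyA H.q H.b t H.V x + applyA H.q H.b t H.V y) ≤
        θ * ε * (2 * H.a - H.κ * W) :=
      mul_le_mul_of_nonneg_left (by rw [hW]; linarith) hθε.le
    have h2 := mul_le_mul_of_nonneg_left hp2 hθ.le
    have h3 : θ * lam * Phi H.V K R ε x y ≤ θ * lam * (1 + ε * W) :=
      mul_le_mul_of_nonneg_left hPhi (by positivity)
    nlinarith
  have hfarineq : L < W → ε * (2 * H.a - H.κ * W) ≤ - (lam * (1 + ε * W)) := by
    intro h
    have h1 : ε * (H.κ * L) ≤ ε * (H.κ * W) := by gcongr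
    have h2 : lam * (ε * W) ≤ H.κ / 4 * (ε * W) :=
      mul_le_mul_of_nonneg_right hlam1 (by positivity)
    have h3 : ε * (4 * H.a) ≤ ε * (H.κ * L) := by gcongr
    nlinarith
  by_cases hrR : R ≤ r
  · refine ⟨0, ?_, by simpa using hfarineq (hfar x y hrR)⟩
    have hexp : Real.exp (-K * r) ≤ Real.exp (-K * R) := Real.exp_le_exp.mpr (by nlinarith)
    have hPhixy : Phi H.V K R ε x y = 1 - Real.exp (-K * R) + ε * W := by
      unfold Phi; rw [min_eq_right (by linarith)]
    have hPhile : ∀ x' y', Phi H.V K R ε x' y' ≤ 1 - Real.exp (-K * R) + ε * (H.V x' + H.V y') := by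
      intro x' y'; unfold Phi; linarith [min_le_right (1 - Real.exp (-K * ‖x' - y'‖)) (1 - Real.exp (-K * R))]
    have hfac : ∀ z, ∃ S : Matrix (Fin d) (Fin d) ℝ, H.q t z = S * S.transpose := by
      intro z
      obtain ⟨S, h1, h2, -⟩ := exists_sqrt_matrix (H.q t z) (H.q_symm t ht z) H.η₀ hη₀ (by
        intro ξ
        have h1 := H.ellipticity t ht z (WithLp.toLp 2 ξ)
        rw [EuclideanSpace.norm_sq_eq] at h1
        simp only [Real.norm_eq_abs, sq_abs] at h1
        refine le_trans ?_ h1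
        exact mul_le_mul_of_nonneg_right (H.η_lb t ht z)
          (Finset.sum_nonneg fun i _ => sq_nonneg _))
      exact ⟨S, by rw [h1.eq, h2]⟩
    obtain ⟨S, hS⟩ := hfac x
    obtain ⟨T, hT⟩ := hfac y
    have m1 := applyA_nonpos_of_max H.q H.b t _ hC₁ x (fun x' => by
      have h1 := hmax x' y
      have h2 := mul_le_mul_of_nonneg_left (hPhile x' y) hθ.le
      rw [hPhixy] at h1
      simp only [hW] at h1
      nlinarith) S hS
    have m2 := applyA_nonpos_of_max H.q H.b t _ hC₂ y (fun y' => by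
      have h1 := hmax x y'
      have h2 := mul_le_mul_of_nonneg_left (hPhile x y') hθ.le
      rw [hPhixy] at h1
      simp only [hW] at h1
      nlinarith) T hT
    linarith
  · push Not at hrR
    refine ⟨-c, ?_, ?_⟩
    · obtain ⟨l, S, T, hl, hS, hT, hST⟩ := hyp_pkg H t ht x y hxy
      have hexp : Real.exp (-K * R) ≤ Real.exp (-K * r) := Real.exp_le_exp.mpr (by nlinarith)
      have hPhixy : Phi H.V K R ε x y = 1 - Real.exp (-K * r) + ε * W := by
        unfold Phi; rw [min_eq_left (by linarith)]
      have hPhile : ∀ x' y', Phi H.V K R ε x' y' ≤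
          1 - Real.exp (-K * ‖x' - y'‖) + ε * (H.V x' + H.V y') := by
        intro x' y'; unfold Phi; linarith [min_le_left (1 - Real.exp (-K * ‖x' - y'‖)) (1 - Real.exp (-K * R))]
      have hEr : Real.exp (H.c₀ * d * r) ≤ E := by
        rw [hE]; exact Real.exp_le_exp.mpr (by gcongr)
      have hll : l₀ ≤ l := by
        refine le_trans ?_ hl
        rw [hl₀, ← hr, Real.exp_neg]
        gcongr
      have hl0 : 0 < l := hl₀0.trans_le hll
      have main := coupling_main H.q H.b t hC₁ hC₂ x y hxy θ K hθ.le hK0.le (by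
        intro x' y'
        have h1 := hmax x' y'
        have h2 := mul_le_mul_of_nonneg_left (hPhile x' y') hθ.le
        rw [hPhixy] at h1
        simp only [hW] at h1
        nlinarith) S T l H.r₀ hl0.le hS hT (hyp_dissip H t ht x y)
      refine main.trans (mul_le_mul_of_nonneg_left ?_ hθ.le)
      rw [← hr]
      have h1 : (∑ i, ∑ j, (S i j - T i j) ^ 2) / r ≤ N * R * l := by
        rw [div_le_iff₀ hr0]
        refine hST.trans ?_
        rw [← hr]
        calc _ ≤ (d:ℝ) ^ 2 * H.c₀ ^ 2 * E ^ 4 * r ^ 2 * l := by gcongr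
          _ = N * l * r * r := by rw [hN]; ring
          _ ≤ N * l * R * r := by gcongr
          _ = _ := by ring
      have h2 : H.r₀ * r ≤ |H.r₀| * R / l₀ * l := by
        calc H.r₀ * r ≤ |H.r₀| * R :=
              mul_le_mul (le_abs_self _) hrR.le hr0.le (abs_nonneg _)
          _ = |H.r₀| * R / l₀ * l₀ := by field_simp
          _ ≤ _ := by gcongr
      have h3 : (∑ i, ∑ j, (S i j - T i j) ^ 2) / r - 4 * K * l + H.r₀ * r ≤ - l₀ := by
        have : 4 * K = N * R + |H.r₀| * R / l₀ + 1 := by rw [hK]; ring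
        rw [this]; nlinarith
      have h4 : 0 < K * Real.exp (-K * r) := by positivity
      calc _ ≤ K * Real.exp (-K * r) * (-l₀) := mul_le_mul_of_nonneg_left h3 h4.le
        _ ≤ K * Real.exp (-K * R) * (-l₀) := by
          have : K * Real.exp (-K * R) * l₀ ≤ K * Real.exp (-K * r) * l₀ := by gcongr
          linarith
        _ = -c := by rw [hc]; ring
    · have hW0 : 0 < W := by rw [hW]; positivity
      have h2 : lam * (ε * W) ≤ H.κ / 4 * (ε * W) :=
        mul_le_mul_of_nonneg_right hlam1 (by positivity)
      have h3 : 0 < H.κ * (ε * W) := by positivity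
      nlinarith

lemma deriv_nonneg_of_left_max {g : ℝ → ℝ} {D s t : ℝ} (hst : s < t) (hg : HasDerivAt g D t)
    (hmax : ∀ τ ∈ Icc s t, g τ ≤ g t) : 0 ≤ D := by
  have h1 := hasDerivWithinAt_iff_tendsto_slope.mp (hg.hasDerivWithinAt (s := Iio t))
  have h2 : Iio t \ {t} = Iio t := by ext; simp
  rw [h2] at h1
  refine ge_of_tendsto h1 ?_
  filter_upwards [Ioo_mem_nhdsLT hst] with τ hτ
  rw [slope_def_field]
  exact div_nonneg_of_nonpos (by linarith [hmax τ ⟨hτ.1.le, hτ.2.le⟩]) (by linarith [hτ.2])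

set_option maxHeartbeats 1000000 in
lemma decay {d : ℕ} (H : Hypotheses d) : ∃ K R ε lam : ℝ, 0 < K ∧ 0 < R ∧ 0 < ε ∧ 0 < lam ∧
    ∀ s ∈ Ici (0:ℝ), ∀ f, IsCb f → ∀ C > (0:ℝ), (∀ x y, f x - f y ≤ C * Phi H.V K R ε x y) →
      ∀ T ∈ Ici s, ∀ x y, H.G T s f x - H.G T s f y ≤
        C * Real.exp (-lam * (T - s)) * Phi H.V K R ε x y := by
  obtain ⟨K, R, ε, lam', hK, hR, hε, hlam', hgen⟩ := generator_ineq H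
  refine ⟨K, R, ε, lam' / 2, hK, hR, hε, by positivity, ?_⟩
  set lam := lam' / 2 with hlam
  have hlam0 : 0 < lam := by positivity
  intro s hs f hf C hC hinit T hT x₁ y₁
  by_contra hcon
  push Not at hcon
  have hsol := H.G_sol s hs f hf
  set u : ℝ → Ed d → ℝ := fun t => H.G t s f with hu
  obtain ⟨M, hM⟩ := hsol.bdd
  set θ : ℝ → ℝ := fun t => C * Real.exp (-lam * (t - s)) with hθ
  have hθ0 : ∀ t, 0 < θ t := fun t => by simp only [hθ]; positivity
  have hθT : ∀ t ≤ T, θ T ≤ θ t := fun t ht => by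
    simp only [hθ]
    exact mul_le_mul_of_nonneg_left (Real.exp_le_exp.mpr (by nlinarith)) hC.le
  have hpsi0 : ∀ x y : Ed d, 0 ≤ min (1 - Real.exp (-K * ‖x - y‖)) (1 - Real.exp (-K * R)) := by
    intro x y
    apply le_min <;> rw [sub_nonneg] <;> apply Real.exp_le_one_iff.mpr
    · nlinarith [norm_nonneg (x - y)]
    · nlinarith
  have hPhi0 : ∀ x y, 0 < Phi H.V K R ε x y := fun x y => by
    have h1 := H.V_pos x
    have h2 := H.V_pos y
    have h3 := hpsi0 x y
    unfold Phi
    have : 0 < ε * (H.V x + H.V y) := by positivity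
    linarith
  set h : ℝ × Ed d × Ed d → ℝ := fun z => u z.1 z.2.1 - u z.1 z.2.2 - θ z.1 * Phi H.V K R ε z.2.1 z.2.2
    with hh
  obtain ⟨ρ, hρ, hVρ⟩ := V_large H (2 * M / (θ T * ε))
  have hout : ∀ t ∈ Icc s T, ∀ x y, (ρ ≤ ‖x‖ ∨ ρ ≤ ‖y‖) → h (t, x, y) ≤ 0 := by
    intro t ht x y hxy
    have hW : 2 * M / (θ T * ε) < H.V x + H.V y := by
      have h1 := H.V_pos x
      have h2 := H.V_pos y
      rcases hxy with h | h
      · linarith [hVρ x h]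
      · linarith [hVρ y h]
    have hTε : 0 < θ T * ε := mul_pos (hθ0 T) hε
    rw [div_lt_iff₀ hTε] at hW
    have h1 : θ T * (ε * (H.V x + H.V y)) ≤ θ t * (ε * (H.V x + H.V y)) := by
      have h1 := H.V_pos x
      have h2 := H.V_pos y
      exact mul_le_mul_of_nonneg_right (hθT t ht.2) (by positivity)
    have h2 : θ t * (ε * (H.V x + H.V y)) ≤ θ t * Phi H.V K R ε x y := by
      refine mul_le_mul_of_nonneg_left ?_ (hθ0 t).le
      unfold Phi
      linarith [hpsi0 x y]
    have h3 := abs_le.mp (hM t ht.1 x)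
    have h4 := abs_le.mp (hM t ht.1 y)
    simp only [hh, hu]
    linarith [h3.2, h4.1]
  have hPhic : Continuous fun z : Ed d × Ed d => Phi H.V K R ε z.1 z.2 := by
    unfold Phi
    have := H.V_C2.continuous
    fun_prop
  have hcont : ContinuousOn h (Icc s T ×ˢ (closedBall 0 ρ ×ˢ closedBall 0 ρ)) := by
    have hc := hsol.cont
    have hx : ContinuousOn (fun z : ℝ × Ed d × Ed d => u z.1 z.2.1)
        (Icc s T ×ˢ (closedBall 0 ρ ×ˢ closedBall 0 ρ)) :=
      hc.comp (f := fun z : ℝ × Ed d × Ed d => (z.1, z.2.1)) (by fun_prop)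
        (fun z hz => ⟨hz.1.1, mem_univ _⟩)
    have hy : ContinuousOn (fun z : ℝ × Ed d × Ed d => u z.1 z.2.2)
        (Icc s T ×ˢ (closedBall 0 ρ ×ˢ closedBall 0 ρ)) :=
      hc.comp (f := fun z : ℝ × Ed d × Ed d => (z.1, z.2.2)) (by fun_prop)
        (fun z hz => ⟨hz.1.1, mem_univ _⟩)
    refine (hx.sub hy).sub (Continuous.continuousOn ?_)
    have h1 : Continuous fun z : ℝ × Ed d × Ed d => θ z.1 := by simp only [hθ]; fun_prop
    exact h1.mul (hPhic.comp continuous_snd)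
  have hTs : s ≤ T := hT
  have hin₁ : (T, x₁, y₁) ∈ Icc s T ×ˢ (closedBall (0 : Ed d) ρ ×ˢ closedBall (0 : Ed d) ρ) := by
    have hpos : 0 < h (T, x₁, y₁) := by simp only [hh, hu, hθ]; linarith
    refine ⟨⟨hTs, le_rfl⟩, ?_, ?_⟩
    · rw [mem_closedBall_zero_iff]
      by_contra hc
      push Not at hc
      linarith [hout T ⟨hTs, le_rfl⟩ x₁ y₁ (Or.inl hc.le)]
    · rw [mem_closedBall_zero_iff]
      by_contra hc
      push Not at hc
      linarith [hout T ⟨hTs, le_rfl⟩ x₁ y₁ (Or.inr hc.le)]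
  obtain ⟨⟨t₀, x₀, y₀⟩, hmem, hmaxon⟩ := (isCompact_Icc.prod
    ((isCompact_closedBall (0 : Ed d) ρ).prod (isCompact_closedBall (0 : Ed d) ρ))).exists_isMaxOn
    ⟨_, hin₁⟩ hcont
  have hpos : 0 < h (t₀, x₀, y₀) := by
    have h1 : h (T, x₁, y₁) ≤ h (t₀, x₀, y₀) := hmaxon hin₁
    have h2 : 0 < h (T, x₁, y₁) := by simp only [hh, hu, hθ]; linarith
    linarith
  have ht₀ : t₀ ∈ Icc s T := hmem.1
  have hmax : ∀ t ∈ Icc s T, ∀ x y, h (t, x, y) ≤ h (t₀, x₀, y₀) := by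
    intro t ht x y
    by_cases hx : ρ ≤ ‖x‖
    · exact (hout t ht x y (Or.inl hx)).trans hpos.le
    by_cases hy : ρ ≤ ‖y‖
    · exact (hout t ht x y (Or.inr hy)).trans hpos.le
    push Not at hx hy
    exact hmaxon (a := (t, x, y)) ⟨ht, by simpa using hx.le, by simpa using hy.le⟩
  have hst₀ : s < t₀ := by
    rcases ht₀.1.lt_or_eq with h1 | h1
    · exact h1
    · exfalso
      have h2 := hinit x₀ y₀
      have h3 : H.G s s f x₀ = f x₀ := hsol.init x₀
      have h4 : H.G s s f y₀ = f y₀ := hsol.init y₀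
      simp only [hh, hu, hθ, ← h1, sub_self, mul_zero, Real.exp_zero, mul_one] at hpos
      rw [h3, h4] at hpos
      linarith
  have hne : x₀ - y₀ ≠ 0 := by
    intro h0
    have h1 : x₀ = y₀ := sub_eq_zero.mp h0
    have h2 := mul_pos (hθ0 t₀) (hPhi0 x₀ y₀)
    simp only [hh, h1, sub_self] at hpos h2
    linarith
  have ht0 : t₀ ∈ Ici (0:ℝ) := le_trans (mem_Ici.mp hs) hst₀.le
  have hspace := hgen t₀ ht0 (u t₀) (hsol.smooth_space t₀ hst₀) x₀ y₀ hne (θ t₀) (hθ0 t₀)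
    (fun x' y' => hmax t₀ ht₀ x' y')
  have hdθ : HasDerivAt θ (θ t₀ * (-lam)) t₀ := by
    have h1 : HasDerivAt (fun t : ℝ => -lam * (t - s)) (-lam) t₀ := by
      simpa using ((hasDerivAt_id t₀).sub_const s).const_mul (-lam)
    exact (h1.exp.const_mul C).congr_deriv (by simp only [hθ]; ring)
  have htime : HasDerivAt (fun τ => h (τ, x₀, y₀)) _ t₀ :=
    ((hsol.pde t₀ hst₀ x₀).sub (hsol.pde t₀ hst₀ y₀)).sub (hdθ.mul_const (Phi H.V K R ε x₀ y₀))
  have hD := deriv_nonneg_of_left_max hst₀ htime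
    (fun τ hτ => hmax τ ⟨hτ.1, hτ.2.trans ht₀.2⟩ x₀ y₀)
  have hP := mul_pos (hθ0 t₀) (hPhi0 x₀ y₀)
  have hl2 : lam' = 2 * lam := by rw [hlam]; ring
  rw [hl2] at hspace
  nlinarith [mul_pos hlam0 hP]

lemma one_sub_exp_lb {K r R : ℝ} (hK : 0 < K) (hr : 0 ≤ r) (hrR : r ≤ R) :
    K * r / (1 + K * R) ≤ 1 - Real.exp (-K * r) := by
  have hKr : 0 ≤ K * r := by positivity
  have hKrR : K * r ≤ K * R := by gcongr
  have h1 : K * r / (1 + K * R) ≤ K * r / (1 + K * r) := by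
    apply div_le_div_of_nonneg_left hKr (by linarith) (by linarith)
  have h2 : Real.exp (-K * r) ≤ 1 / (1 + K * r) := by
    rw [neg_mul, Real.exp_neg, ← one_div]
    apply one_div_le_one_div_of_le (by linarith)
    linarith [Real.add_one_le_exp (K * r)]
  have h3 : K * r / (1 + K * r) = 1 - 1 / (1 + K * r) := by
    field_simp
    ring
  linarith

lemma init_bound {d : ℕ} (V : Ed d → ℝ) (hV : ∀ x, 0 < V x) {K R ε : ℝ} (hK : 0 < K)
    (hR : 0 < R) (hε : 0 < ε) (f : Ed d → ℝ) (M L : ℝ) (hL : 0 ≤ L) (hM : ∀ x, |f x| ≤ M)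
    (hf : ∀ x y, |f x - f y| ≤ L * ‖x - y‖) :
    ∃ C > (0:ℝ), ∀ x y, f x - f y ≤ C * Phi V K R ε x y := by
  have hM0 : 0 ≤ M := (abs_nonneg _).trans (hM 0)
  have hKR : 0 < K * R := by positivity
  have hD : 0 < 1 - Real.exp (-K * R) := by
    have : Real.exp (-K * R) < 1 := by
      rw [Real.exp_lt_one_iff]
      linarith
    linarith
  set D := 1 - Real.exp (-K * R) with hDdef
  have hA : 0 ≤ L * (1 + K * R) / K := by positivity
  have hB : 0 ≤ 2 * M / D := by positivity
  refine ⟨L * (1 + K * R) / K + 2 * M / D + 1, by positivity, fun x y => ?_⟩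
  have hVV : 0 ≤ ε * (V x + V y) := by
    have := hV x
    have := hV y
    positivity
  unfold Phi
  rw [← hDdef]
  set C := L * (1 + K * R) / K + 2 * M / D + 1 with hC
  have hCpos : 0 < C := by positivity
  have hgoal : f x - f y ≤ C * min (1 - Real.exp (-K * ‖x - y‖)) D := by
    rcases le_total ‖x - y‖ R with h | h
    · have hmin : min (1 - Real.exp (-K * ‖x - y‖)) D = 1 - Real.exp (-K * ‖x - y‖) := by
        apply min_eq_left
        have : Real.exp (-K * R) ≤ Real.exp (-K * ‖x - y‖) := by
          apply Real.exp_le_exp.mpr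
          nlinarith
        linarith
      rw [hmin]
      have h1 := one_sub_exp_lb hK (norm_nonneg (x - y)) h
      calc f x - f y ≤ L * ‖x - y‖ := (le_abs_self _).trans (hf x y)
        _ = L * (1 + K * R) / K * (K * ‖x - y‖ / (1 + K * R)) := by
            have : 1 + K * R ≠ 0 := by positivity
            field_simp
        _ ≤ C * (1 - Real.exp (-K * ‖x - y‖)) := by
            apply mul_le_mul (by linarith) h1 (by positivity) hCpos.le
    · have hmin : min (1 - Real.exp (-K * ‖x - y‖)) D = D := by
        apply min_eq_right
        have : Real.exp (-K * ‖x - y‖) ≤ Real.exp (-K * R) := by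
          apply Real.exp_le_exp.mpr
          nlinarith
        linarith
      rw [hmin]
      have h1 := abs_le.mp (hM x)
      have h2 := abs_le.mp (hM y)
      calc f x - f y ≤ 2 * M := by linarith
        _ = 2 * M / D * D := by field_simp
        _ ≤ C * D := by
            apply mul_le_mul_of_nonneg_right _ hD.le
            linarith
  nlinarith [mul_nonneg hCpos.le hVV]

lemma Phi_le {d : ℕ} (V : Ed d → ℝ) {K R ε W : ℝ} (hε : 0 < ε) (x y : Ed d) (hx : V x ≤ W)
    (hy : V y ≤ W) : Phi V K R ε x y ≤ 1 + ε * (2 * W) := by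
  unfold Phi
  have h1 : min (1 - Real.exp (-K * ‖x - y‖)) (1 - Real.exp (-K * R)) ≤ 1 := by
    refine (min_le_right _ _).trans ?_
    linarith [Real.exp_pos (-K * R)]
  have h2 : ε * (V x + V y) ≤ ε * (2 * W) := by
    gcongr
    linarith
  linarith

lemma integral_near {d : ℕ} (μ : Measure (Ed d)) [IsProbabilityMeasure μ] (u : Ed d → ℝ)
    (hu : Continuous u) (M R δ ε : ℝ) (hM : ∀ x, |u x| ≤ M) (hε : 0 ≤ ε)
    (hδ : ∀ x ∈ ball (0 : Ed d) R, |u x - u 0| ≤ δ) (hδ0 : 0 ≤ δ)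
    (hμ : ENNReal.ofReal (1 - ε) ≤ μ (ball (0 : Ed d) R)) :
    |∫ x, u x ∂μ - u 0| ≤ δ + 2 * M * ε := by
  have hM0 : 0 ≤ M := (abs_nonneg _).trans (hM 0)
  have hu_int : Integrable u μ := by
    apply Integrable.of_bound hu.aestronglyMeasurable M
    exact Eventually.of_forall hM
  have hu_int2 : Integrable (fun x => u x - u 0) μ := hu_int.sub (integrable_const _)
  have h1 : ∫ x, u x ∂μ - u 0 = ∫ x, (u x - u 0) ∂μ := by
    rw [integral_sub hu_int (integrable_const _)]
    simp
  have hms : MeasurableSet (ball (0 : Ed d) R)ᶜ := measurableSet_ball.compl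
  have hreal : μ.real (ball (0 : Ed d) R)ᶜ ≤ ε := by
    rw [probReal_compl_eq_one_sub measurableSet_ball]
    have : 1 - ε ≤ μ.real (ball (0 : Ed d) R) :=
      (ENNReal.ofReal_le_iff_le_toReal (measure_ne_top _ _)).mp hμ
    linarith
  have hind : Integrable ((ball (0 : Ed d) R)ᶜ.indicator fun _ => 2 * M) μ :=
    (integrable_const _).indicator hms
  calc |∫ x, u x ∂μ - u 0| = |∫ x, (u x - u 0) ∂μ| := by rw [h1]
    _ ≤ ∫ x, |u x - u 0| ∂μ := abs_integral_le_integral_abs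
    _ ≤ ∫ x, (δ + (ball (0 : Ed d) R)ᶜ.indicator (fun _ => 2 * M) x) ∂μ := by
        apply integral_mono hu_int2.abs ((integrable_const _).add hind)
        intro x
        by_cases hx : x ∈ ball (0 : Ed d) R
        · have := hδ x hx
          simpa [hx] using this
        · have h2 := abs_le.mp (hM x)
          have h3 := abs_le.mp (hM 0)
          have h4 : |u x - u 0| ≤ 2 * M := abs_le.mpr ⟨by linarith, by linarith⟩
          have h5 : (ball (0 : Ed d) R)ᶜ.indicator (fun _ => 2 * M) x = 2 * M :=
            indicator_of_mem hx _
          simp only [Pi.add_apply, h5]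
          linarith
    _ = δ + 2 * M * μ.real (ball (0 : Ed d) R)ᶜ := by
        rw [integral_add (integrable_const _) hind, integral_indicator hms]
        simp [mul_comm]
    _ ≤ δ + 2 * M * ε := by gcongr

lemma integral_eq_of_lipschitz {d : ℕ} (H : Hypotheses d)
    (μ₁ μ₂ : ℝ → Measure (Ed d))
    (hsys₁ : IsEvolutionSystem H μ₁) (htight₁ : IsTightSystem μ₁)
    (hsys₂ : IsEvolutionSystem H μ₂) (htight₂ : IsTightSystem μ₂) (s : ℝ) (hs : s ∈ Ici (0:ℝ))
    (f : Ed d → ℝ) (M L : ℝ) (hfc : Continuous f) (hL : 0 ≤ L) (hM : ∀ x, |f x| ≤ M)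
    (hf : ∀ x y, |f x - f y| ≤ L * ‖x - y‖) :
    ∫ x, f x ∂μ₁ s = ∫ x, f x ∂μ₂ s := by
  obtain ⟨K, R, ε, lam, hK, hR, hε, hlam, hdec⟩ := decay H
  obtain ⟨C, hC, hinit⟩ := init_bound H.V H.V_pos hK hR hε f M L hL hM hf
  have hcb : IsCb f := ⟨hfc, M, hM⟩
  have hd := hdec s hs f hcb C hC hinit
  have hsol := H.G_sol s hs f hcb
  obtain ⟨N, hN⟩ := hsol.bdd
  have hN0 : 0 ≤ N := (abs_nonneg _).trans (hN s self_mem_Ici 0)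
  have key : ∀ ε' > (0:ℝ), |∫ x, f x ∂μ₁ s - ∫ x, f x ∂μ₂ s| ≤ 2 * (ε' + 2 * N * ε') := by
    intro ε' hε'
    obtain ⟨R₁, hR₁, h₁⟩ := htight₁ ε' hε'
    obtain ⟨R₂, hR₂, h₂⟩ := htight₂ ε' hε'
    set R' := max R₁ R₂
    obtain ⟨W, hW⟩ := (isCompact_closedBall (0 : Ed d) R').bddAbove_image
      H.V_C2.continuous.continuousOn
    have hW' : ∀ x ∈ closedBall (0 : Ed d) R', H.V x ≤ W := fun x hx =>
      hW (mem_image_of_mem _ hx)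
    have hlim : Tendsto (fun t : ℝ => C * Real.exp (-lam * (t - s)) * (1 + ε * (2 * W)))
        atTop (𝓝 0) := by
      have e1 : Tendsto (fun t : ℝ => lam * (t - s)) atTop atTop :=
        (tendsto_atTop_add_const_right _ (-s) tendsto_id).const_mul_atTop hlam
      have e2 := (Real.tendsto_exp_neg_atTop_nhds_zero.comp e1).const_mul C
      have e3 := e2.mul_const (1 + ε * (2 * W))
      simpa using e3
    obtain ⟨t, ht1, ht2⟩ := ((hlim.eventually (gt_mem_nhds hε')).and
      (eventually_gt_atTop s)).exists
    have hosc : ∀ x ∈ closedBall (0 : Ed d) R', |H.G t s f x - H.G t s f 0| ≤ ε' := by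
      intro x hx
      have h0 : (0 : Ed d) ∈ closedBall (0 : Ed d) R' :=
        mem_closedBall_self (hR₁.le.trans (le_max_left _ _))
      have hb : ∀ x ∈ closedBall (0 : Ed d) R', ∀ y ∈ closedBall (0 : Ed d) R',
          H.G t s f x - H.G t s f y ≤ ε' := by
        intro x hx y hy
        refine (hd t ht2.le x y).trans (le_trans ?_ ht1.le)
        have := Phi_le (K := K) (R := R) H.V hε x y (hW' x hx) (hW' y hy)
        have hp : 0 ≤ C * Real.exp (-lam * (t - s)) := by positivity
        exact mul_le_mul_of_nonneg_left this hp
      exact abs_le.mpr ⟨by linarith [hb 0 h0 x hx], hb x hx 0 h0⟩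
    have ht0 : t ∈ Ici (0:ℝ) := (mem_Ici.mp hs).trans ht2.le
    have hcont : Continuous (H.G t s f) := (hsol.smooth_space t ht2).continuous
    haveI := hsys₁.1 t ht0
    haveI := hsys₂.1 t ht0
    have k1 := integral_near (μ₁ t) (H.G t s f) hcont N R₁ ε' ε' (hN t ht2.le) hε'.le
      (fun x hx => hosc x (ball_subset_closedBall.trans
        (closedBall_subset_closedBall (le_max_left _ _)) hx)) hε'.le (h₁ t ht0)
    have k2 := integral_near (μ₂ t) (H.G t s f) hcont N R₂ ε' ε' (hN t ht2.le) hε'.le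
      (fun x hx => hosc x (ball_subset_closedBall.trans
        (closedBall_subset_closedBall (le_max_right _ _)) hx)) hε'.le (h₂ t ht0)
    rw [hsys₁.2 f hcb s hs t ht2.le] at k1
    rw [hsys₂.2 f hcb s hs t ht2.le] at k2
    have k1 := abs_le.mp k1
    have k2 := abs_le.mp k2
    exact abs_le.mpr ⟨by linarith, by linarith⟩
  by_contra hne
  have hpos : 0 < |∫ x, f x ∂μ₁ s - ∫ x, f x ∂μ₂ s| := abs_pos.mpr (sub_ne_zero.mpr hne)
  set D := |∫ x, f x ∂μ₁ s - ∫ x, f x ∂μ₂ s|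
  have := key (D / (4 * (1 + 2 * N))) (by positivity)
  have e : 2 * (D / (4 * (1 + 2 * N)) + 2 * N * (D / (4 * (1 + 2 * N)))) = D / 2 := by
    field_simp
    ring
  linarith

lemma measure_eq_of_lipschitz {d : ℕ} (μ ν : Measure (Ed d)) [IsProbabilityMeasure μ]
    [IsProbabilityMeasure ν]
    (h : ∀ (f : Ed d → ℝ) (M L : ℝ), Continuous f → 0 ≤ L → (∀ x, |f x| ≤ M) →
      (∀ x y, |f x - f y| ≤ L * ‖x - y‖) → ∫ x, f x ∂μ = ∫ x, f x ∂ν) : μ = ν := by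
  refine ext_of_generate_finite {F : Set (Ed d) | IsClosed F} ?_ isPiSystem_isClosed ?_ (by simp)
  · rw [BorelSpace.measurable_eq (α := Ed d), borel_eq_generateFrom_isClosed]
  intro F hF
  have hpos : ∀ n : ℕ, 0 < 1 / ((n : ℝ) + 1) := fun n => Nat.one_div_pos_of_nat
  have hlim : Tendsto (fun n : ℕ => 1 / ((n : ℝ) + 1)) atTop (𝓝 0) :=
    tendsto_one_div_add_atTop_nhds_zero_nat
  have t1 := tendsto_integral_thickenedIndicator_of_isClosed μ hF hpos hlim
  have t2 := tendsto_integral_thickenedIndicator_of_isClosed ν hF hpos hlim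
  have heq : ∀ n : ℕ, ∫ x, (thickenedIndicator (hpos n) F x : ℝ) ∂μ =
      ∫ x, (thickenedIndicator (hpos n) F x : ℝ) ∂ν := by
    intro n
    have hl := lipschitzWith_thickenedIndicator (hpos n) F
    refine h _ 1 ((1 / ((n : ℝ) + 1)).toNNReal⁻¹ : NNReal) ?_ (NNReal.coe_nonneg _) ?_ ?_
    · exact NNReal.continuous_coe.comp hl.continuous
    · intro x
      rw [abs_of_nonneg (NNReal.coe_nonneg _)]
      exact_mod_cast thickenedIndicator_le_one (hpos n) F x
    · intro x y
      have := hl.dist_le_mul x y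
      rwa [NNReal.dist_eq, dist_eq_norm] at this
  have : μ.real F = ν.real F := by
    refine tendsto_nhds_unique t1 (t2.congr fun n => (heq n).symm)
  exact (measureReal_eq_measureReal_iff).mp this

/-- `G(t,s)` admits at most one tight evolution system of measures. -/
theorem uniqueness_of_tight_evolution_system (d : ℕ) (H : Hypotheses d)
    (μ₁ μ₂ : ℝ → Measure (Ed d))
    (hsys₁ : IsEvolutionSystem H μ₁) (htight₁ : IsTightSystem μ₁)
    (hsys₂ : IsEvolutionSystem H μ₂) (htight₂ : IsTightSystem μ₂) :
    ∀ t ∈ Ici (0:ℝ), μ₁ t = μ₂ t := by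
  intro t ht
  haveI := hsys₁.1 t ht
  haveI := hsys₂.1 t ht
  refine measure_eq_of_lipschitz (μ₁ t) (μ₂ t) fun f M L hfc hL hM hf => ?_
  exact integral_eq_of_lipschitz H μ₁ μ₂ hsys₁ htight₁ hsys₂ htight₂ t ht f M L hfc hL hM hf
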